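/- arXiv:1703.07704 — 3 statements merged into one kernel-verified Lean document; each statement's English description precedes it below -/
import Mathlib

section
/- Let X, U, Θ be sets and γ : X → U → Θ → Set X a parametric transition function, and define the adaptive transition relation γ^adp on X × Set Θ by: (x', ϑ') ∈ γ^adp (x, ϑ) u iff there exists θ ∈ ϑ with x' ∈ γ x u θ and ϑ' = {θ ∈ ϑ | x' ∈ γ x u θ}. Fix sequences x : ℕ → X, u : ℕ → U, and ϑ : ℕ → Set Θ such that ϑ 0 = Θ and (x (k+1), ϑ (k+1)) ∈ γ^adp (x k, ϑ k) (u k) for all k ∈ ℕ. Then for every k ∈ ℕ, the second component of the adaptive state coincides with the parameter estimator: ϑ k = {θ ∈ Θ | ∀ i < k, x (i+1) ∈ γ (x i) (u i) θ}. -/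
/-- The adaptive transition relation `γ^adp` of the adaptive transition system (ATS):
`(x', ϑ') ∈ γ^adp (x, ϑ) u` iff there exists `θ ∈ ϑ` with `x' ∈ γ x u θ` and
`ϑ' = {θ ∈ ϑ | x' ∈ γ x u θ}`. -/
def adpTrans {X U Θ : Type*} (γ : X → U → Θ → Set X) :
    X × Set Θ → U → Set (X × Set Θ) :=
  fun p u =>
    {p' | (∃ θ ∈ p.2, p'.1 ∈ γ p.1 u θ) ∧ p'.2 = {θ ∈ p.2 | p'.1 ∈ γ p.1 u θ}}

/-- Along any trajectory of the ATS starting with `ϑ 0 = Θ`, the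
second component coincides with the parameter estimator. -/
theorem ats_second_component_is_estimator {X U Θ : Type*}
    (γ : X → U → Θ → Set X) (x : ℕ → X) (u : ℕ → U) (ϑ : ℕ → Set Θ)
    (h0 : ϑ 0 = (Set.univ : Set Θ))
    (hstep : ∀ k, (x (k + 1), ϑ (k + 1)) ∈ adpTrans γ (x k, ϑ k) (u k)) :
    ∀ k, ϑ k = {θ : Θ | ∀ i < k, x (i + 1) ∈ γ (x i) (u i) θ} := by
  intro k
  induction k with
  | zero => simp [h0]
  | succ k ih =>
    have h : ϑ (k + 1) = {θ ∈ ϑ k | x (k + 1) ∈ γ (x k) (u k) θ} := (hstep k).2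
    ext θ
    simp only [h, ih, Set.mem_ofPred_eq, Nat.forall_lt_succ_right]
end

section
/- Let X, U, Θ be sets, γ : X → U → Θ → Set X a parametric transition function, Π a set of atomic propositions, and O : X → Set Π an observation map. Define the adaptive transition relation γ^adp on X × Set Θ by: (x', ϑ') ∈ γ^adp (x, ϑ) u iff there exists θ ∈ ϑ with x' ∈ γ x u θ and ϑ' = {θ ∈ ϑ | x' ∈ γ x u θ}, and the adaptive observation O^adp (x, ϑ) := O x. Suppose θ* ∈ Θ and the sequences x : ℕ → X, u : ℕ → U satisfy x (k+1) ∈ γ (x k) (u k) θ* for all k ∈ ℕ, and define ϑ k := {θ ∈ Θ | ∀ i < k, x (i+1) ∈ γ (x i) (u i) θ}. Then the sequence k ↦ (x k, ϑ k) is a trajectory of the ATS: ϑ 0 = Θ, (x (k+1), ϑ (k+1)) ∈ γ^adp (x k, ϑ k) (u k) for all k, every ϑ k is nonempty, and the produced word is unchanged: O^adp (x k, ϑ k) = O (x k) for all k. -/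
/-- The adaptive observation map `O^adp (x, ϑ) := O x`. -/
def adpObs {X Θ AP : Type*} (O : X → Set AP) : X × Set Θ → Set AP :=
  fun p => O p.1

/-- If a trajectory of the PTS is generated by a ground-truth
parameter `θ*`, then pairing states with the parameter estimates yields a
trajectory of the ATS: `ϑ 0 = Θ`, each step is an adaptive transition, every
`ϑ k` is nonempty, and the produced word is unchanged. -/
theorem ground_truth_traj_is_ats_traj {X U Θ AP : Type*}
    (γ : X → U → Θ → Set X) (O : X → Set AP)
    (θstar : Θ) (x : ℕ → X) (u : ℕ → U)
    (hθstar : ∀ k, x (k + 1) ∈ γ (x k) (u k) θstar)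
    (ϑ : ℕ → Set Θ)
    (hϑ : ∀ k, ϑ k = {θ : Θ | ∀ i < k, x (i + 1) ∈ γ (x i) (u i) θ}) :
    ϑ 0 = (Set.univ : Set Θ) ∧
    (∀ k, (x (k + 1), ϑ (k + 1)) ∈ adpTrans γ (x k, ϑ k) (u k)) ∧
    (∀ k, (ϑ k).Nonempty) ∧
    (∀ k, adpObs O (x k, ϑ k) = O (x k)) := by
  have mem_estimate : ∀ k, θstar ∈ ϑ k := fun k => by
    rw [hϑ k]
    exact fun i _ => hθstar i
  refine ⟨by simp [hϑ 0], fun k => ⟨⟨θstar, mem_estimate k, hθstar k⟩, ?_⟩,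
    fun k => ⟨θstar, mem_estimate k⟩, fun _ => rfl⟩
  ext θ
  simp only [hϑ, Set.mem_ofPred_eq, Nat.forall_lt_succ_right]
end

section
/- Let T = (X, U, β, Π, O) be a transition system, Q an observation-preserving partition of X with cell map c : X → Q, β_Q and O_Q the quotient transition function and observation map, Λ_Q : List Q → List U → U a control strategy for the quotient, and Q₀ ⊆ Q. Let W be any set of infinite words over Set Π. If every infinite word in the quotient language L(T_Q, Λ_Q, Q₀) belongs to W, then for every pair of sequences x : ℕ → X, u : ℕ → U with c (x 0) ∈ Q₀, u k = Λ_Q [c (x 0), …, c (x k)] [u 0, …, u (k−1)], and x (k+1) ∈ β (x k) (u k) for all k, the word O (x 0) O (x 1) ⋯ belongs to W. In particular, a control strategy satisfying a specification on the finite quotient also satisfies it when implemented on the original system. -/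
/-- The quotient transition function
`β_Q(q, u) := {q' ∈ Q | ∃ x ∈ q, ∃ x' ∈ q', x' ∈ β x u}`. -/
def quotTrans {X U : Type*} (Q : Set (Set X)) (β : X → U → Set X) :
    Set X → U → Set (Set X) :=
  fun q u => {q' | q' ∈ Q ∧ ∃ x ∈ q, ∃ x' ∈ q', x' ∈ β x u}

/-- The language `L(T_Q, Λ_Q, Q₀)` of a quotient transition system. -/
def quotLang {X U AP : Type*} (βQ : Set X → U → Set (Set X))
    (OQ : Set X → Set AP) (Λ : List (Set X) → List U → U)
    (Q₀ : Set (Set X)) : Set (ℕ → Set AP) :=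
  {w | ∃ q : ℕ → Set X, ∃ u : ℕ → U,
    q 0 ∈ Q₀ ∧
    (∀ k, u k = Λ ((List.range (k + 1)).map q) ((List.range k).map u)) ∧
    (∀ k, q (k + 1) ∈ βQ (q k) (u k)) ∧
    (∀ k, w k = OQ (q k))}

/-- If every word of the quotient language lies in `W`, then the
word produced by any trajectory of the original system controlled by the
quotient strategy lies in `W` as well: a strategy satisfying a specification
on the quotient also satisfies it on the original system. -/
theorem quotient_strategy_correct_on_original {X U AP : Type*}
    (β : X → U → Set X) (O : X → Set AP)
    (Q : Set (Set X))
    (hQ₁ : ∅ ∉ Q) (hQ₂ : ⋃₀ Q = Set.univ)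
    (hQ₃ : ∀ q ∈ Q, ∀ q' ∈ Q, q ≠ q' → q ∩ q' = ∅)
    (c : X → Set X) (hc : ∀ x, c x ∈ Q ∧ x ∈ c x)
    (hobs : ∀ q ∈ Q, ∀ x ∈ q, ∀ x' ∈ q, O x = O x')
    (OQ : Set X → Set AP) (hOQ : ∀ x : X, OQ (c x) = O x)
    (Λ : List (Set X) → List U → U)
    (Q₀ : Set (Set X)) (hQ₀ : Q₀ ⊆ Q)
    (W : Set (ℕ → Set AP))
    (hW : quotLang (quotTrans Q β) OQ Λ Q₀ ⊆ W) :
    ∀ (x : ℕ → X) (u : ℕ → U),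
      c (x 0) ∈ Q₀ →
      (∀ k, u k = Λ ((List.range (k + 1)).map (fun i => c (x i)))
          ((List.range k).map u)) →
      (∀ k, x (k + 1) ∈ β (x k) (u k)) →
      (fun k => O (x k)) ∈ W := by
  intro x u h₀ hu hx
  exact hW ⟨fun k => c (x k), u, h₀, hu,
    fun k => ⟨(hc _).1, x k, (hc _).2, x (k + 1), (hc _).2, hx k⟩,
    fun k => (hOQ (x k)).symm⟩
end
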